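/- arXiv:2509.09220 — 3 statements merged into one kernel-verified Lean document; each statement's English description precedes it below -/
import Mathlib

section
/- Let A = σ(R)⟨x_1,…,x_n⟩ be a skew PBW extension of a ring R. If R is a Baer ring, R is (Σ,Δ)-compatible, and R satisfies condition (SA1), then A has Property (a.c.) on the right. -/
/-! Basic annihilator-condition definitions for (noncommutative) rings. -/

/-- The right annihilator `r_S(X) = {a ∈ S | Xa = 0}` of a subset `X` of a ring `S`. -/
def rAnn {S : Type*} [Ring S] (X : Set S) : Set S := {a | ∀ x ∈ X, x * a = 0}

/-- The left annihilator `ℓ_S(X) = {a ∈ S | aX = 0}` of a subset `X` of a ring `S`. -/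
def lAnn {S : Type*} [Ring S] (X : Set S) : Set S := {a | ∀ x ∈ X, a * x = 0}

/-- The principal right ideal `xS` of a ring `S`. -/
def rIdeal {S : Type*} [Ring S] (x : S) : Set S := Set.range fun s => x * s

/-- The principal left ideal `Sx` of a ring `S`. -/
def lIdeal {S : Type*} [Ring S] (x : S) : Set S := Set.range fun s => s * x

/-- A ring `S` is Baer if the right annihilator of every nonempty subset is
generated (as a right ideal) by an idempotent. -/
def IsBaerRing (S : Type*) [Ring S] : Prop :=
  ∀ X : Set S, X.Nonempty → ∃ e : S, e * e = e ∧ rAnn X = rIdeal e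

/-- A ring `S` is a right p.p.-ring if the right annihilator of every element is
generated by an idempotent. -/
def IsRightPP (S : Type*) [Ring S] : Prop :=
  ∀ a : S, ∃ e : S, e * e = e ∧ rAnn {a} = rIdeal e

/-- A ring `S` is a left p.p.-ring if the left annihilator of every element is
generated by an idempotent. -/
def IsLeftPP (S : Type*) [Ring S] : Prop :=
  ∀ a : S, ∃ e : S, e * e = e ∧ lAnn {a} = lIdeal e

/-- A ring `S` is right p.q.-Baer if the right annihilator of every principal right
ideal is generated by an idempotent. -/
def IsRightPQBaer (S : Type*) [Ring S] : Prop :=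
  ∀ a : S, ∃ e : S, e * e = e ∧ rAnn (rIdeal a) = rIdeal e

/-- A ring `S` is left p.q.-Baer if the left annihilator of every principal left
ideal is generated by an idempotent. -/
def IsLeftPQBaer (S : Type*) [Ring S] : Prop :=
  ∀ a : S, ∃ e : S, e * e = e ∧ lAnn (lIdeal a) = lIdeal e

/-- Property (a.c.) on the right: for every finitely generated right ideal
`I = a₁S + ⋯ + a_mS` there is `c` with `r_S(I) = r_S(cS)`. -/
def HasRightAC (S : Type*) [Ring S] : Prop :=
  ∀ (m : ℕ) (a : Fin m → S), ∃ c : S,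
    rAnn {y : S | ∃ s : Fin m → S, y = ∑ i, a i * s i} = rAnn (rIdeal c)

/-- Property (a.c.) on the left: for every finitely generated left ideal
`I = Sa₁ + ⋯ + Sa_m` there is `c` with `ℓ_S(I) = ℓ_S(Sc)`. -/
def HasLeftAC (S : Type*) [Ring S] : Prop :=
  ∀ (m : ℕ) (a : Fin m → S), ∃ c : S,
    lAnn {y : S | ∃ s : Fin m → S, y = ∑ i, s i * a i} = lAnn (lIdeal c)

/-- A ring is Abelian if every idempotent is central. -/
def IsAbelianRing (S : Type*) [Ring S] : Prop :=
  ∀ e : S, e * e = e → ∀ r : S, e * r = r * e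

/-- A ring `S` is NI if the set of nilpotent elements coincides with the upper
nilradical `nil*(S)`, the sum of all (two-sided) nil ideals of `S`. -/
def IsNIRing (S : Type*) [Ring S] : Prop :=
  {a : S | IsNilpotent a} =
    ((sSup {I : TwoSidedIdeal S | ∀ x ∈ I, IsNilpotent x} : TwoSidedIdeal S) : Set S)

/-- `σ^α = σ₁^{α₁} ∘ ⋯ ∘ σₙ^{αₙ}` for a family of ring endomorphisms. -/
def sigmaPow {R : Type*} [Ring R] {n : ℕ} (σ : Fin n → R →+* R) (α : Fin n → ℕ) : R → R :=
  (List.ofFn fun i => (⇑(σ i))^[α i]).foldr (· ∘ ·) id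

/-- `δ^α = δ₁^{α₁} ∘ ⋯ ∘ δₙ^{αₙ}` for a family of maps. -/
def deltaPow {R : Type*} {n : ℕ} (δ : Fin n → R → R) (α : Fin n → ℕ) : R → R :=
  (List.ofFn fun i => (δ i)^[α i]).foldr (· ∘ ·) id

/-- The ordered standard monomial `x^α = x₁^{α₁} ⋯ xₙ^{αₙ}`. -/
def monom {A : Type*} [Ring A] {n : ℕ} (x : Fin n → A) (α : Fin n → ℕ) : A :=
  (List.ofFn fun i => x i ^ α i).prod

/-- A skew PBW extension `A = σ(R)⟨x₁,…,xₙ⟩` of a ring `R`: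
`R` embeds in `A` (sharing the identity), `A` is a free left `R`-module with basis the
standard monomials, there are injective endomorphisms `σᵢ` and `σᵢ`-derivations `δᵢ`
with `xᵢ r = σᵢ(r) xᵢ + δᵢ(r)`, and `xⱼxᵢ - d_{i,j} xᵢxⱼ ∈ R + Rx₁ + ⋯ + Rxₙ`
with `d_{i,j} ≠ 0`. -/
structure SkewPBWExt (R A : Type*) [Ring R] [Ring A] (n : ℕ) where
  /-- the inclusion of `R` into `A` -/
  ι : R →+* A
  ι_inj : Function.Injective ι
  /-- the variables `x₁, …, xₙ` -/
  x : Fin n → A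
  /-- the endomorphisms `σᵢ` -/
  σ : Fin n → R →+* R
  σ_inj : ∀ i, Function.Injective (σ i)
  /-- the `σᵢ`-derivations `δᵢ` -/
  δ : Fin n → R → R
  δ_add : ∀ (i : Fin n) (a b : R), δ i (a + b) = δ i a + δ i b
  δ_leibniz : ∀ (i : Fin n) (a b : R), δ i (a * b) = σ i a * δ i b + δ i a * b
  comm_rel : ∀ (i : Fin n) (r : R), x i * ι r = ι (σ i r) * x i + ι (δ i r)
  /-- `A` is a free left `R`-module with basis the standard monomials: every element
  has a unique representation as a finite left `R`-linear combination of monomials. -/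
  basis : ∀ f : A, ∃! c : (Fin n → ℕ) →₀ R, f = c.sum fun α r => ι r * monom x α
  /-- the constants `d_{i,j}` -/
  d : Fin n → Fin n → R
  d_ne : ∀ i j, d i j ≠ 0
  quad : ∀ i j, ∃ (r0 : R) (rc : Fin n → R),
    x j * x i - ι (d i j) * (x i * x j) = ι r0 + ∑ k, ι (rc k) * x k

namespace SkewPBWExt

variable {R A : Type*} [Ring R] [Ring A] {n : ℕ}

/-- `R` is `(Σ,Δ)`-compatible. -/
def SigmaDeltaCompatible (E : SkewPBWExt R A n) : Prop :=
  ∀ (a b : R) (α : Fin n → ℕ),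
    (a * b = 0 ↔ a * sigmaPow E.σ α b = 0) ∧ (a * b = 0 → a * deltaPow E.δ α b = 0)

/-- `R` is `Σ`-rigid. -/
def SigmaRigid (E : SkewPBWExt R A n) : Prop :=
  ∀ (a : R) (α : Fin n → ℕ), a * sigmaPow E.σ α a = 0 → a = 0

/-- Condition (SA1): if `fg = 0` in `A` then all products of coefficients vanish. -/
def SA1 (E : SkewPBWExt R A n) : Prop :=
  ∀ cf cg : (Fin n → ℕ) →₀ R,
    (cf.sum fun α r => E.ι r * monom E.x α) * (cg.sum fun β r => E.ι r * monom E.x β) = 0 →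
    ∀ α β, cf α * cg β = 0

/-- The extension is bijective: every `σᵢ` is bijective and every `d_{i,j}` (`i < j`)
is invertible in `R`. -/
def Bijective (E : SkewPBWExt R A n) : Prop :=
  (∀ i, Function.Bijective (E.σ i)) ∧ ∀ i j : Fin n, i < j → IsUnit (E.d i j)

end SkewPBWExt


theorem foldr_comp_ofFn_iterate_single {X : Type*} {n : ℕ} (f : Fin n → X → X) (i : Fin n) :
    (List.ofFn fun j => (f j)^[(Pi.single i 1 : Fin n → ℕ) j]).foldr (· ∘ ·) id = f i := by
  have foldr_replicate_id : ∀ k : ℕ, (List.replicate k (id : X → X)).foldr (· ∘ ·) id = id := by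
    intro k
    induction k with
    | zero => rfl
    | succ k ih => simp [List.replicate_succ, ih]
  induction n with
  | zero => exact i.elim0
  | succ n ih =>
    rw [List.ofFn_succ, List.foldr_cons]
    cases i using Fin.cases with
    | zero => simp [List.ofFn_const, foldr_replicate_id]
    | succ i =>
      have h := ih (fun j => f j.succ) i
      have hs : (fun j : Fin n => (f j.succ)^[(Pi.single i.succ 1 : Fin (n + 1) → ℕ) j.succ]) =
          fun j => (f j.succ)^[(Pi.single i 1 : Fin n → ℕ) j] := by
        funext j
        simp [Pi.single_apply]
      rw [hs, h]
      simp [(Fin.succ_ne_zero i).symm]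

/-- In a Baer ring the right annihilator of a right ideal is `eS` with `e` left semicentral,
so it is also the right annihilator of `(1 - e)S`. -/
theorem IsBaerRing.hasRightAC {S : Type*} [Ring S] (h : IsBaerRing S) : HasRightAC S := by
  intro m a
  obtain ⟨e, he, hann⟩ := h {y : S | ∃ s : Fin m → S, y = ∑ i, a i * s i} ⟨_, 0, rfl⟩
  have he_mem : e ∈ rAnn {y : S | ∃ s : Fin m → S, y = ∑ i, a i * s i} := by
    rw [hann]
    exact ⟨e, he⟩
  have hsemi : ∀ r : S, e * (r * e) = r * e := by
    intro r
    have hr : r * e ∈ rAnn {y : S | ∃ s : Fin m → S, y = ∑ i, a i * s i} := by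
      rintro _ ⟨s, rfl⟩
      rw [← mul_assoc]
      refine he_mem _ ⟨fun i => s i * r, ?_⟩
      simp [Finset.sum_mul, mul_assoc]
    rw [hann] at hr
    obtain ⟨t, ht⟩ := hr
    simp only at ht
    rw [← ht, ← mul_assoc, he]
  refine ⟨1 - e, ?_⟩
  rw [hann]
  ext y
  constructor
  · rintro ⟨t, rfl⟩ _ ⟨s, rfl⟩
    have hs := hsemi s
    calc (1 - e) * s * (e * t) = (s * e - e * (s * e)) * t := by noncomm_ring
      _ = 0 := by rw [hs, sub_self, zero_mul]
  · intro hy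
    have h1 := hy (1 - e) ⟨1, mul_one _⟩
    rw [sub_mul, one_mul, sub_eq_zero] at h1
    exact ⟨y, h1.symm⟩

namespace SkewPBWExt

variable {R A : Type*} [Ring R] [Ring A] {n : ℕ} {E : SkewPBWExt R A n}

theorem SigmaDeltaCompatible.mul_sigma_eq_zero (h : E.SigmaDeltaCompatible) {a b : R}
    (hab : a * b = 0) (i : Fin n) : a * E.σ i b = 0 := by
  have := (h a b (Pi.single i 1)).1.1 hab
  rwa [sigmaPow, foldr_comp_ofFn_iterate_single (fun j => ⇑(E.σ j)) i] at this

theorem SigmaDeltaCompatible.mul_delta_eq_zero (h : E.SigmaDeltaCompatible) {a b : R}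
    (hab : a * b = 0) (i : Fin n) : a * E.δ i b = 0 := by
  have := (h a b (Pi.single i 1)).2 hab
  rwa [deltaPow, foldr_comp_ofFn_iterate_single E.δ i] at this

/-- Under compatibility, monomials may be inserted into a vanishing product of coefficients. -/
theorem SigmaDeltaCompatible.mul_monom_mul_eq_zero (h : E.SigmaDeltaCompatible) {a b : R}
    (hab : a * b = 0) (α : Fin n → ℕ) : E.ι a * monom E.x α * E.ι b = 0 := by
  have step : ∀ (u : A) (i : Fin n), (∀ b, a * b = 0 → u * E.ι b = 0) →
      ∀ b, a * b = 0 → u * E.x i * E.ι b = 0 := by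
    intro u i hu b hb
    rw [mul_assoc, E.comm_rel, mul_add, ← mul_assoc, hu _ (h.mul_sigma_eq_zero hb i),
      hu _ (h.mul_delta_eq_zero hb i), zero_mul, add_zero]
  have step_pow : ∀ (i : Fin n) (k : ℕ) (u : A), (∀ b, a * b = 0 → u * E.ι b = 0) →
      ∀ b, a * b = 0 → u * E.x i ^ k * E.ι b = 0 := by
    intro i k
    induction k with
    | zero => simp
    | succ k ih =>
      intro u hu
      rw [pow_succ, ← mul_assoc]
      exact step _ i (ih u hu)
  have step_list : ∀ (l : List A), (∀ y ∈ l, ∃ i k, y = E.x i ^ k) → ∀ u : A,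
      (∀ b, a * b = 0 → u * E.ι b = 0) → ∀ b, a * b = 0 → u * l.prod * E.ι b = 0 := by
    intro l
    induction l with
    | nil => simp
    | cons y l ih =>
      intro hl u hu
      obtain ⟨i, k, rfl⟩ := hl y List.mem_cons_self
      rw [List.prod_cons, ← mul_assoc]
      exact ih (fun z hz => hl z (List.mem_cons_of_mem _ hz)) _ (step_pow i k u hu)
  refine step_list _ ?_ _ (fun b hb => by rw [← map_mul, hb, map_zero]) b hab
  intro y hy
  obtain ⟨i, rfl⟩ := (List.mem_ofFn' _ _).1 hy
  exact ⟨i, α i, rfl⟩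

/-- A compatible skew PBW extension satisfying (SA1) inherits the Baer property. -/
theorem isBaerRing (hBaer : IsBaerRing R) (hcomp : E.SigmaDeltaCompatible) (hSA1 : E.SA1) :
    IsBaerRing A := by
  rintro X ⟨f₀, hf₀⟩
  obtain ⟨e, he, hann⟩ := hBaer
    {r | ∃ (c : (Fin n → ℕ) →₀ R) (α : Fin n → ℕ),
      (c.sum fun α r => E.ι r * monom E.x α) ∈ X ∧ c α = r} (by
    obtain ⟨c, rfl, -⟩ := E.basis f₀
    exact ⟨_, c, 0, hf₀, rfl⟩)
  refine ⟨E.ι e, by rw [← map_mul, he], ?_⟩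
  ext g
  constructor
  · intro hg
    obtain ⟨cg, rfl, -⟩ := E.basis g
    have hcg : ∀ β, e * cg β = cg β := by
      intro β
      have hβ : cg β ∈ rIdeal e := by
        rw [← hann]
        rintro _ ⟨c, α, hc, rfl⟩
        exact hSA1 c cg (hg _ hc) α β
      obtain ⟨t, ht⟩ := hβ
      simp only at ht
      rw [← ht, ← mul_assoc, he]
    refine ⟨cg.sum fun β r => E.ι r * monom E.x β, ?_⟩
    simp only [Finsupp.sum, Finset.mul_sum]
    refine Finset.sum_congr rfl fun β _ => ?_
    rw [← mul_assoc, ← map_mul, hcg]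
  · rintro ⟨t, rfl⟩ f hf
    obtain ⟨c, rfl, -⟩ := E.basis f
    have he_mem : e ∈ rIdeal e := ⟨e, he⟩
    rw [← hann] at he_mem
    simp only
    rw [← mul_assoc, Finsupp.sum, Finset.sum_mul, Finset.sum_eq_zero, zero_mul]
    intro α _
    exact hcomp.mul_monom_mul_eq_zero (he_mem _ ⟨c, α, hf, rfl⟩) α

end SkewPBWExt

/-- If `R` is Baer, `(Σ,Δ)`-compatible and satisfies (SA1), then the skew PBW
extension `A` has Property (a.c.) on the right. -/
theorem baer_compatible_SA1_hasRightAC {R A : Type*} [Ring R] [Ring A] {n : ℕ} (E : SkewPBWExt R A n)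
    (hBaer : IsBaerRing R) (hcomp : E.SigmaDeltaCompatible) (hSA1 : E.SA1) :
    HasRightAC A :=
  (SkewPBWExt.isBaerRing hBaer hcomp hSA1).hasRightAC
end

section
/- Let A = σ(R)⟨x_1,…,x_n⟩ be a skew PBW extension of a ring R. If R is a Baer ring, R is (Σ,Δ)-compatible, and R satisfies condition (SA1), then A is a Baer ring. -/
/-- If all but one map of a finite family are the identity, then the composite of the family
is the remaining map. -/
theorem foldr_comp_ofFn_eq_of_forall_ne {S : Type*} {n : ℕ} (g : Fin n → S → S) (i : Fin n)
    (h : ∀ j, j ≠ i → g j = id) : (List.ofFn g).foldr (· ∘ ·) id = g i := by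
  have all_id : ∀ (m : ℕ) (g : Fin m → S → S), (∀ j, g j = id) →
      (List.ofFn g).foldr (· ∘ ·) id = id := by
    intro m
    induction m with
    | zero => intro g _; simp
    | succ m ih =>
      intro g hg
      rw [List.ofFn_succ, List.foldr_cons, ih _ fun j => hg j.succ, hg 0]
      rfl
  induction n with
  | zero => exact i.elim0
  | succ n ih =>
    rw [List.ofFn_succ, List.foldr_cons]
    cases i using Fin.cases with
    | zero =>
      rw [all_id n _ fun j => h j.succ (Fin.succ_ne_zero j)]
      rfl
    | succ i =>
      rw [ih (fun j => g j.succ) i fun j hj => h j.succ fun hji => hj (Fin.succ_injective n hji),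
        h 0 (Fin.succ_ne_zero i).symm]
      rfl

theorem sigmaPow_single {R : Type*} [Ring R] {n : ℕ} (σ : Fin n → R →+* R) (i : Fin n) :
    sigmaPow σ (Pi.single i 1) = σ i := by
  unfold sigmaPow
  rw [foldr_comp_ofFn_eq_of_forall_ne _ i fun j hj => by simp [hj]]
  simp

theorem deltaPow_single {R : Type*} {n : ℕ} (δ : Fin n → R → R) (i : Fin n) :
    deltaPow δ (Pi.single i 1) = δ i := by
  unfold deltaPow
  rw [foldr_comp_ofFn_eq_of_forall_ne _ i fun j hj => by simp [hj]]
  simp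

namespace SkewPBWExt

variable {R A : Type*} [Ring R] [Ring A] {n : ℕ}

theorem SigmaDeltaCompatible.ι_mul_mul_ι_eq_zero {E : SkewPBWExt R A n}
    (h : E.SigmaDeltaCompatible) {a b : R} (hab : a * b = 0) {w : A}
    (hw : w ∈ Submonoid.closure (Set.range E.x)) : E.ι a * w * E.ι b = 0 := by
  induction hw using Submonoid.closure_induction_right generalizing b with
  | one => rw [mul_one, ← map_mul, hab, map_zero]
  | mul_right w _ y hy ih =>
    obtain ⟨i, rfl⟩ := hy
    have hσ : a * E.σ i b = 0 := by
      simpa [sigmaPow_single] using (h a b (Pi.single i 1)).1.1 hab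
    have hδ : a * E.δ i b = 0 := by
      simpa [deltaPow_single] using (h a b (Pi.single i 1)).2 hab
    rw [mul_assoc, mul_assoc, E.comm_rel, mul_add, mul_add, ← mul_assoc w, ← mul_assoc,
      ← mul_assoc (E.ι a) w, ih hσ, ← mul_assoc, ih hδ, zero_mul, add_zero]

theorem monom_mem_closure (x : Fin n → A) (α : Fin n → ℕ) :
    monom x α ∈ Submonoid.closure (Set.range x) := by
  refine Submonoid.list_prod_mem _ fun y hy => ?_
  obtain ⟨i, rfl⟩ := (List.mem_ofFn' _ _).1 hy
  exact pow_mem (Submonoid.subset_closure (Set.mem_range_self i)) _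

end SkewPBWExt

/-- If `R` is Baer, `(Σ,Δ)`-compatible and satisfies (SA1), then the skew PBW
extension `A` is a Baer ring. -/
theorem baer_compatible_SA1_isBaer {R A : Type*} [Ring R] [Ring A] {n : ℕ} (E : SkewPBWExt R A n)
    (hBaer : IsBaerRing R) (hcomp : E.SigmaDeltaCompatible) (hSA1 : E.SA1) :
    IsBaerRing A := by
  rintro X ⟨f₀, hf₀⟩
  choose c hc using fun f => (E.basis f).exists
  obtain ⟨e, he, hann⟩ := hBaer {r | ∃ f ∈ X, ∃ α, c f α = r} ⟨c f₀ 0, f₀, hf₀, 0, rfl⟩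
  have ann_e : ∀ f ∈ X, ∀ α, c f α * e = 0 := by
    have he_mem : e ∈ rIdeal e := ⟨e, he⟩
    rw [← hann] at he_mem
    exact fun f hf α => he_mem _ ⟨f, hf, α, rfl⟩
  refine ⟨E.ι e, by rw [← map_mul, he], Set.Subset.antisymm (fun g hg => ⟨g, ?_⟩) ?_⟩
  · have hcoeff : ∀ β, e * c g β = c g β := by
      intro β
      have hmem : c g β ∈ rIdeal e := by
        rw [← hann]
        rintro _ ⟨f, hf, α, rfl⟩
        exact hSA1 (c f) (c g) (by rw [← hc, ← hc]; exact hg f hf) α β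
      obtain ⟨s, hs⟩ := hmem
      rw [← hs, ← mul_assoc, he]
    change E.ι e * g = g
    conv_lhs => rw [hc g]
    conv_rhs => rw [hc g]
    simp only [Finsupp.sum, Finset.mul_sum, ← mul_assoc, ← map_mul, hcoeff]
  · rintro _ ⟨s, rfl⟩ f hf
    have hfe : f * E.ι e = 0 := by
      rw [hc f, Finsupp.sum, Finset.sum_mul]
      exact Finset.sum_eq_zero fun α _ =>
        hcomp.ι_mul_mul_ι_eq_zero (ann_e f hf α) (SkewPBWExt.monom_mem_closure E.x α)
    change f * (E.ι e * s) = 0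
    rw [← mul_assoc, hfe, zero_mul]
end

section
/- Let A = σ(R)⟨x_1,…,x_n⟩ be a bijective skew PBW extension of a ring R. If R is a right p.q.-Baer ring and R is (Σ,Δ)-compatible, then A has Property (a.c.) on the right. -/
theorem monom_zero {A : Type*} [Ring A] {n : ℕ} (x : Fin n → A) : monom x 0 = 1 := by
  simp [monom, List.ofFn_const]

theorem monom_succ {A : Type*} [Ring A] {n : ℕ} (x : Fin (n + 1) → A) (α : Fin (n + 1) → ℕ) :
    monom x α = x 0 ^ α 0 * monom (fun i => x i.succ) (fun i => α i.succ) := by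
  simp [monom, List.ofFn_succ]

/-- Multiplying a standard monomial on the left by a variable that precedes all the variables
occurring in it yields a standard monomial. -/
theorem monom_add_single {A : Type*} [Ring A] {n : ℕ} (x : Fin n → A) (j : Fin n)
    (α : Fin n → ℕ) (h : ∀ k < j, α k = 0) :
    monom x (α + Pi.single j 1) = x j * monom x α := by
  induction n with
  | zero => exact j.elim0
  | succ n ih =>
    rw [monom_succ, monom_succ]
    refine Fin.cases (fun _ => ?_) (fun j h => ?_) j h
    · have : (fun i : Fin n => (α + Pi.single 0 1 : Fin (n + 1) → ℕ) i.succ)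
          = fun i => α i.succ := by
        funext i
        simp
      rw [this]
      simp [pow_succ', mul_assoc]
    · have h0 : α 0 = 0 := h 0 (Fin.succ_pos j)
      have : (fun i : Fin n => (α + Pi.single j.succ 1 : Fin (n + 1) → ℕ) i.succ)
          = (fun i => α i.succ) + Pi.single j 1 := by
        funext i
        simp [Pi.single_apply]
      rw [this, ih _ _ _ fun k hk => h _ (Fin.succ_lt_succ_iff.2 hk)]
      simp [h0]

/-- Every nonzero exponent vector splits off its first variable. -/
theorem exists_eq_add_single {n : ℕ} {α : Fin n → ℕ} (h : α ≠ 0) :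
    ∃ (j : Fin n) (β : Fin n → ℕ), (∀ k < j, α k = 0) ∧ α = β + Pi.single j 1 := by
  classical
  have hex : ∃ j, α j ≠ 0 := Function.ne_iff.1 h
  let j := (Finset.univ.filter fun j => α j ≠ 0).min' (hex.imp fun j hj => by simpa using hj)
  have hj : α j ≠ 0 := by
    have := (Finset.univ.filter fun j => α j ≠ 0).min'_mem (hex.imp fun j hj => by simpa using hj)
    simpa using this
  refine ⟨j, α - Pi.single j 1, fun k hk => ?_, ?_⟩
  · by_contra hne
    exact absurd (Finset.min'_le (Finset.univ.filter fun j => α j ≠ 0) k (by simpa using hne))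
      (not_le.2 hk)
  · funext i
    by_cases hi : i = j
    · subst hi
      simp only [Pi.add_apply, Pi.sub_apply, Pi.single_eq_same]
      omega
    · simp [hi]

theorem sum_add_single {n : ℕ} (α : Fin n → ℕ) (j : Fin n) :
    ∑ i, (α + Pi.single j 1 : Fin n → ℕ) i = ∑ i, α i + 1 := by
  simp [Finset.sum_add_distrib]

theorem exponent_induction {n : ℕ} {P : (Fin n → ℕ) → Prop} (zero : P 0)
    (step : ∀ (α : Fin n → ℕ) (j : Fin n), (∀ k < j, α k = 0) → P α → P (α + Pi.single j 1))
    (α : Fin n → ℕ) : P α := by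
  induction hd : ∑ i, α i generalizing α with
  | zero =>
    have : α = 0 := by
      funext i
      exact (Finset.sum_eq_zero_iff.1 hd) i (Finset.mem_univ i)
    exact this ▸ zero
  | succ d ih =>
    have hne : α ≠ 0 := by
      rintro rfl
      simp at hd
    obtain ⟨j, β, hj, rfl⟩ := exists_eq_add_single hne
    rw [sum_add_single] at hd
    refine step β j (fun k hk => ?_) (ih β (by omega))
    have := hj k hk
    simp only [Pi.add_apply] at this
    omega

/-- In a right p.q.-Baer ring the right annihilator of the right ideal generated by a finite set
is generated by an idempotent. -/
theorem IsRightPQBaer.exists_finset {R : Type*} [Ring R] (hpq : IsRightPQBaer R) (C : Finset R) :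
    ∃ e : R, e * e = e ∧ ∀ b, (∀ c ∈ C, ∀ r, c * r * b = 0) ↔ e * b = b := by
  classical
  induction C using Finset.induction_on with
  | empty => exact ⟨1, by simp⟩
  | insert a C _ ih =>
    obtain ⟨e', he', h'⟩ := ih
    obtain ⟨e, he, h⟩ := hpq a
    have ha : ∀ b, (∀ r, a * r * b = 0) ↔ e * b = b := by
      intro b
      have hb : b ∈ rAnn (rIdeal a) ↔ b ∈ rIdeal e := by rw [h]
      have hl : b ∈ rAnn (rIdeal a) ↔ ∀ r, a * r * b = 0 := Set.forall_mem_range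
      rw [← hl, hb]
      constructor
      · rintro ⟨s, rfl⟩
        dsimp only
        rw [← mul_assoc, he]
      · exact fun hb => ⟨b, hb⟩
    have hee : e' * (e * e') = e * e' := by
      refine (h' _).1 fun c hc r => ?_
      have := (h' e').2 he' c hc (r * e)
      simpa only [mul_assoc] using this
    refine ⟨e * e', by rw [mul_assoc, hee, ← mul_assoc, he], fun b => ?_⟩
    rw [Finset.forall_mem_insert, ha, h']
    constructor
    · rintro ⟨h1, h2⟩
      rw [mul_assoc, h2, h1]
    · intro hb
      constructor
      · conv_lhs => rw [← hb]
        rw [← mul_assoc, ← mul_assoc, he, hb]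
      · conv_lhs => rw [← hb]
        rw [← mul_assoc, hee, hb]

namespace SkewPBWExt

variable {R A : Type*} [Ring R] [Ring A] {n : ℕ} (E : SkewPBWExt R A n)

/-- The element of `A` with prescribed coefficients in the basis of standard monomials. -/
noncomputable def ofCoeff : ((Fin n → ℕ) →₀ R) →+ A :=
  Finsupp.liftAddHom fun α => (AddMonoidHom.mulRight (monom E.x α)).comp E.ι.toAddMonoidHom

theorem ofCoeff_apply (c : (Fin n → ℕ) →₀ R) :
    E.ofCoeff c = c.sum fun α r => E.ι r * monom E.x α := rfl

theorem ofCoeff_single (α : Fin n → ℕ) (r : R) :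
    E.ofCoeff (Finsupp.single α r) = E.ι r * monom E.x α := by
  simp [ofCoeff_apply]

theorem ofCoeff_bijective : Function.Bijective E.ofCoeff := by
  rw [Function.bijective_iff_existsUnique]
  intro f
  simpa only [ofCoeff_apply, eq_comm] using E.basis f

/-- The coefficients of an element of `A` in the basis of standard monomials. -/
noncomputable def coeff : A ≃+ ((Fin n → ℕ) →₀ R) :=
  (AddEquiv.ofBijective E.ofCoeff E.ofCoeff_bijective).symm

theorem coeff_ofCoeff (c : (Fin n → ℕ) →₀ R) : E.coeff (E.ofCoeff c) = c :=
  (AddEquiv.ofBijective E.ofCoeff E.ofCoeff_bijective).symm_apply_apply c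

theorem ofCoeff_coeff (f : A) : E.ofCoeff (E.coeff f) = f :=
  (AddEquiv.ofBijective E.ofCoeff E.ofCoeff_bijective).apply_symm_apply f

theorem coeff_term (α : Fin n → ℕ) (r : R) :
    E.coeff (E.ι r * monom E.x α) = Finsupp.single α r := by
  rw [← ofCoeff_single, coeff_ofCoeff]

theorem ι_mul_ofCoeff (e : R) (c : (Fin n → ℕ) →₀ R) :
    E.ι e * E.ofCoeff c = E.ofCoeff (c.mapRange (e * ·) (mul_zero e)) := by
  rw [ofCoeff_apply, ofCoeff_apply, Finsupp.sum_mapRange_index (by simp), Finsupp.mul_sum]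
  simp [mul_assoc]

theorem subring_eq_top (T : Subring A) (hι : ∀ r, E.ι r ∈ T) (hx : ∀ i, E.x i ∈ T) : T = ⊤ := by
  refine eq_top_iff.2 fun f _ => ?_
  rw [← E.ofCoeff_coeff f, ofCoeff_apply]
  refine T.sum_mem fun α _ => T.mul_mem (hι _) (T.list_prod_mem ?_)
  intro y hy
  obtain ⟨i, rfl⟩ := (List.mem_ofFn' _ _).1 hy
  exact T.pow_mem (hx i) _

/-- The elements of `A` of degree less than `d`. -/
def low (d : ℕ) : AddSubgroup A :=
  AddSubgroup.closure {y | ∃ (r : R) (α : Fin n → ℕ), ∑ i, α i < d ∧ y = E.ι r * monom E.x α}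

variable {E}

theorem term_mem_low {d : ℕ} (r : R) {α : Fin n → ℕ} (h : ∑ i, α i < d) :
    E.ι r * monom E.x α ∈ E.low d :=
  AddSubgroup.subset_closure ⟨r, α, h, rfl⟩

theorem low_le {d : ℕ} {S : AddSubgroup A}
    (h : ∀ (r : R) (α : Fin n → ℕ), ∑ i, α i < d → E.ι r * monom E.x α ∈ S) : E.low d ≤ S := by
  refine (AddSubgroup.closure_le _).2 ?_
  rintro _ ⟨r, α, hα, rfl⟩
  exact h r α hα

theorem low_mono {d e : ℕ} (h : d ≤ e) : E.low d ≤ E.low e :=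
  low_le fun r _ hα => term_mem_low r (hα.trans_le h)

theorem ι_mul_mem_low {d : ℕ} (r : R) {y : A} (hy : y ∈ E.low d) : E.ι r * y ∈ E.low d := by
  refine (low_le (S := (E.low d).comap (AddMonoidHom.mulLeft (E.ι r))) fun s α hα => ?_) hy
  simpa [mul_assoc] using term_mem_low (E := E) (r * s) hα

theorem coeff_low {d : ℕ} {y : A} (hy : y ∈ E.low d) {γ : Fin n → ℕ} (hγ : d ≤ ∑ i, γ i) :
    E.coeff y γ = 0 := by
  refine (low_le (S := ((Finsupp.applyAddHom γ).comp E.coeff.toAddMonoidHom).ker)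
    fun s α hα => ?_) hy
  have : α ≠ γ := by
    rintro rfl
    omega
  change E.coeff (E.ι s * monom E.x α) γ = 0
  rw [coeff_term, Finsupp.single_eq_of_ne this.symm]

theorem x_mul_mem_low_of {d : ℕ}
    (h : ∀ (i : Fin n) (α : Fin n → ℕ), ∑ k, α k < d →
      ∃ u : R, E.x i * monom E.x α - E.ι u * monom E.x (α + Pi.single i 1)
        ∈ E.low (∑ k, α k + 1))
    (i : Fin n) {y : A} (hy : y ∈ E.low d) : E.x i * y ∈ E.low (d + 1) := by
  refine (low_le (S := (E.low (d + 1)).comap (AddMonoidHom.mulLeft (E.x i)))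
    fun r α hα => ?_) hy
  obtain ⟨u, hu⟩ := h i α hα
  have key : E.x i * (E.ι r * monom E.x α) =
      E.ι (E.σ i r) * (E.x i * monom E.x α - E.ι u * monom E.x (α + Pi.single i 1))
      + E.ι (E.σ i r * u) * monom E.x (α + Pi.single i 1) + E.ι (E.δ i r) * monom E.x α := by
    rw [← mul_assoc, E.comm_rel]
    simp only [map_mul]
    noncomm_ring
  simp only [AddSubgroup.mem_comap, AddMonoidHom.coe_mulLeft]
  rw [key]
  refine add_mem (add_mem (low_mono (by omega) (ι_mul_mem_low _ hu)) (term_mem_low _ ?_))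
    (term_mem_low _ (by omega))
  rw [sum_add_single]
  omega

/-- A variable times a standard monomial, modulo terms of lower degree. -/
theorem x_mul_monom (hd : ∀ i j : Fin n, i < j → IsUnit (E.d i j)) (i : Fin n) (α : Fin n → ℕ) :
    ∃ u : R, IsUnit u ∧ E.x i * monom E.x α - E.ι u * monom E.x (α + Pi.single i 1)
        ∈ E.low (∑ k, α k + 1) := by
  induction hN : ∑ k, α k using Nat.strong_induction_on generalizing i α with
  | _ N ih =>
    subst hN
    by_cases h : ∀ k < i, α k = 0
    · refine ⟨1, isUnit_one, ?_⟩
      rw [monom_add_single _ _ _ h]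
      simp
    have hα : α ≠ 0 := by
      rintro rfl
      simp at h
    obtain ⟨j, β, hj, rfl⟩ := exists_eq_add_single hα
    have hji : j < i := by
      by_contra hij
      exact h fun k hk => hj k (hk.trans_le (not_lt.1 hij))
    have hβ : ∀ k < j, β k = 0 := fun k hk => by
      have := hj k hk
      simp only [Pi.add_apply] at this
      omega
    rw [sum_add_single] at ih ⊢
    have hx : ∀ (k : Fin n) {y : A}, y ∈ E.low (∑ k, β k + 1) → E.x k * y ∈ E.low (∑ k, β k + 2) :=
      fun k y hy => x_mul_mem_low_of (fun i α hα => (ih _ hα i α rfl).imp fun u hu => hu.2) k hy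
    obtain ⟨u, hu, hmem⟩ := ih (∑ k, β k) (Nat.lt_succ_self _) i β rfl
    obtain ⟨r0, rc, hq⟩ := E.quad j i
    have hxm : ∀ k, E.x k * monom E.x β ∈ E.low (∑ k, β k + 2) := fun k =>
      hx k (by simpa using term_mem_low (E := E) 1 (Nat.lt_succ_self (∑ k, β k)))
    refine ⟨E.d j i * E.σ j u, (hd j i hji).mul (hu.map (E.σ j)), ?_⟩
    have hswap : β + Pi.single j 1 + Pi.single i 1 = β + Pi.single i 1 + Pi.single j 1 :=
      add_right_comm _ _ _
    rw [hswap, monom_add_single E.x j β hβ,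
      monom_add_single E.x j (β + Pi.single i 1) fun k hk => by
        simp [hβ k hk, (hk.trans hji).ne]]
    have hq' : E.x i * E.x j =
        E.ι (E.d j i) * (E.x j * E.x i) + (E.ι r0 + ∑ k, E.ι (rc k) * E.x k) := by
      rw [← hq]
      abel
    have hc := E.comm_rel j u
    have key : E.x i * (E.x j * monom E.x β) -
          E.ι (E.d j i * E.σ j u) * (E.x j * monom E.x (β + Pi.single i 1)) =
        E.ι (E.d j i) * (E.x j *
          (E.x i * monom E.x β - E.ι u * monom E.x (β + Pi.single i 1))) +
        E.ι (E.d j i * E.δ j u) * monom E.x (β + Pi.single i 1) +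
        E.ι r0 * monom E.x β + ∑ k, E.ι (rc k) * (E.x k * monom E.x β) := by
      have h1 : E.x j * (E.ι u * monom E.x (β + Pi.single i 1)) =
          E.ι (E.σ j u) * (E.x j * monom E.x (β + Pi.single i 1)) +
          E.ι (E.δ j u) * monom E.x (β + Pi.single i 1) := by
        rw [← mul_assoc, hc, add_mul, mul_assoc]
      rw [← mul_assoc (E.x i), hq', mul_sub (E.x j), h1]
      simp only [← mul_assoc, ← Finset.sum_mul, map_mul]
      noncomm_ring
    rw [key]
    refine add_mem (add_mem (add_mem (ι_mul_mem_low _ (hx j hmem)) (term_mem_low _ ?_))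
      (term_mem_low _ (by omega))) (sum_mem fun k _ => ι_mul_mem_low _ (hxm k))
    rw [sum_add_single]
    omega

theorem x_mul_mem_low (hd : ∀ i j : Fin n, i < j → IsUnit (E.d i j)) {d : ℕ} (i : Fin n) {y : A}
    (hy : y ∈ E.low d) : E.x i * y ∈ E.low (d + 1) :=
  x_mul_mem_low_of (fun i α _ => (x_mul_monom hd i α).imp fun _ hu => hu.2) i hy

/-- The product of two standard monomials, modulo terms of lower degree. -/
theorem monom_mul_monom (hd : ∀ i j : Fin n, i < j → IsUnit (E.d i j)) (α β : Fin n → ℕ) :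
    ∃ u : R, IsUnit u ∧ monom E.x α * monom E.x β - E.ι u * monom E.x (α + β)
        ∈ E.low (∑ k, α k + ∑ k, β k) := by
  induction α using exponent_induction with
  | zero => exact ⟨1, isUnit_one, by simp [monom_zero]⟩
  | step α j hj ih =>
    obtain ⟨u, hu, hmem⟩ := ih
    obtain ⟨v, hv, hmem'⟩ := x_mul_monom hd j (α + β)
    refine ⟨E.σ j u * v, (hu.map (E.σ j)).mul hv, ?_⟩
    rw [monom_add_single _ _ _ hj, sum_add_single, add_right_comm α]
    have hs : ∑ k, (α + β) k = ∑ k, α k + ∑ k, β k := Finset.sum_add_distrib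
    have key : E.x j * monom E.x α * monom E.x β -
          E.ι (E.σ j u * v) * monom E.x (α + β + Pi.single j 1) =
        E.x j * (monom E.x α * monom E.x β - E.ι u * monom E.x (α + β)) +
        E.ι (E.σ j u) * (E.x j * monom E.x (α + β) -
          E.ι v * monom E.x (α + β + Pi.single j 1)) +
        E.ι (E.δ j u) * monom E.x (α + β) := by
      have h1 : E.x j * (E.ι u * monom E.x (α + β)) =
          E.ι (E.σ j u) * (E.x j * monom E.x (α + β)) + E.ι (E.δ j u) * monom E.x (α + β) := by
        rw [← mul_assoc, E.comm_rel, add_mul, mul_assoc]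
      rw [mul_sub (E.x j), h1]
      simp only [map_mul]
      noncomm_ring
    rw [key]
    refine add_mem (add_mem (low_mono (by omega) (x_mul_mem_low hd j hmem))
      (ι_mul_mem_low _ (low_mono (by omega) hmem'))) (term_mem_low _ (by omega))

theorem mul_monom_mem_low (hd : ∀ i j : Fin n, i < j → IsUnit (E.d i j)) {d : ℕ}
    (β : Fin n → ℕ) {y : A} (hy : y ∈ E.low d) : y * monom E.x β ∈ E.low (d + ∑ k, β k) := by
  refine (low_le (S := (E.low _).comap (AddMonoidHom.mulRight (monom E.x β)))
    fun r α hα => ?_) hy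
  obtain ⟨u, -, hu⟩ := monom_mul_monom hd α β
  have key : E.ι r * monom E.x α * monom E.x β =
      E.ι r * (monom E.x α * monom E.x β - E.ι u * monom E.x (α + β)) +
      E.ι (r * u) * monom E.x (α + β) := by
    simp only [map_mul]
    noncomm_ring
  simp only [AddSubgroup.mem_comap, AddMonoidHom.coe_mulRight]
  rw [key]
  have hs : ∑ k, (α + β) k = ∑ k, α k + ∑ k, β k := Finset.sum_add_distrib
  exact add_mem (ι_mul_mem_low _ (low_mono (by omega) hu)) (term_mem_low _ (by omega))

theorem SigmaDeltaCompatible.sigma (hcomp : E.SigmaDeltaCompatible) (a b : R) (i : Fin n) :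
    a * b = 0 ↔ a * E.σ i b = 0 := by
  simpa only [sigmaPow_single] using (hcomp a b (Pi.single i 1)).1

theorem SigmaDeltaCompatible.delta (hcomp : E.SigmaDeltaCompatible) {a b : R} (i : Fin n)
    (h : a * b = 0) : a * E.δ i b = 0 := by
  simpa only [deltaPow_single] using (hcomp a b (Pi.single i 1)).2 h

/-- A standard monomial times a scalar, modulo terms of lower degree. -/
theorem monom_mul_ι (hbij : E.Bijective) (hcomp : E.SigmaDeltaCompatible) (α : Fin n → ℕ) :
    ∃ τ : R →+* R, Function.Surjective τ ∧ (∀ a b, a * b = 0 ↔ a * τ b = 0) ∧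
      ∀ r, monom E.x α * E.ι r - E.ι (τ r) * monom E.x α ∈ E.low (∑ k, α k) := by
  induction α using exponent_induction with
  | zero => exact ⟨RingHom.id R, Function.surjective_id, by simp [monom_zero]⟩
  | step α j hj ih =>
    obtain ⟨τ, hτ, hτc, hmem⟩ := ih
    refine ⟨(E.σ j).comp τ, (hbij.1 j).surjective.comp hτ,
      fun a b => (hτc a b).trans (hcomp.sigma _ _ j), fun r => ?_⟩
    rw [monom_add_single _ _ _ hj, sum_add_single]
    have key : E.x j * monom E.x α * E.ι r - E.ι (E.σ j (τ r)) * (E.x j * monom E.x α) =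
        E.x j * (monom E.x α * E.ι r - E.ι (τ r) * monom E.x α) +
        E.ι (E.δ j (τ r)) * monom E.x α := by
      have h1 : E.x j * (E.ι (τ r) * monom E.x α) =
          E.ι (E.σ j (τ r)) * (E.x j * monom E.x α) + E.ι (E.δ j (τ r)) * monom E.x α := by
        rw [← mul_assoc, E.comm_rel, add_mul, mul_assoc]
      rw [mul_sub (E.x j), h1]
      noncomm_ring
    rw [RingHom.comp_apply, key]
    exact add_mem (x_mul_mem_low hbij.2 j (hmem r)) (term_mem_low _ (by omega))

/-- The product of two terms, modulo terms of lower degree. -/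
theorem term_mul_term (hbij : E.Bijective) (hcomp : E.SigmaDeltaCompatible) (α β : Fin n → ℕ) :
    ∃ (τ : R →+* R) (u : R), Function.Surjective τ ∧ IsUnit u ∧
      (∀ a b, a * b = 0 ↔ a * τ b = 0) ∧
      ∀ a b, E.ι a * monom E.x α * (E.ι b * monom E.x β) -
        E.ι (a * τ b * u) * monom E.x (α + β) ∈ E.low (∑ k, α k + ∑ k, β k) := by
  obtain ⟨τ, hτ, hτc, hmem⟩ := monom_mul_ι hbij hcomp α
  obtain ⟨u, hu, hmem'⟩ := monom_mul_monom hbij.2 α β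
  refine ⟨τ, u, hτ, hu, hτc, fun a b => ?_⟩
  have key : E.ι a * monom E.x α * (E.ι b * monom E.x β) -
        E.ι (a * τ b * u) * monom E.x (α + β) =
      E.ι a * ((monom E.x α * E.ι b - E.ι (τ b) * monom E.x α) * monom E.x β) +
      E.ι (a * τ b) * (monom E.x α * monom E.x β - E.ι u * monom E.x (α + β)) := by
    simp only [map_mul]
    noncomm_ring
  rw [key]
  exact add_mem (ι_mul_mem_low _ (mul_monom_mem_low hbij.2 β (hmem b))) (ι_mul_mem_low _ hmem')

/-- If `aRe = 0` then `aAe = 0`. -/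
theorem ι_mul_mul_ι (hcomp : E.SigmaDeltaCompatible) {a e : R} (h : ∀ r, a * r * e = 0) (y : A) :
    E.ι a * y * E.ι e = 0 := by
  let T : Subring A :=
    { carrier := {z | ∀ y, (∀ b, (∀ r, a * r * b = 0) → E.ι a * y * E.ι b = 0) →
        ∀ b, (∀ r, a * r * b = 0) → E.ι a * (y * z) * E.ι b = 0}
      mul_mem' := fun {z w} hz hw y hy b hb => by
        rw [← mul_assoc y]
        exact hw _ (hz y hy) b hb
      one_mem' := fun y hy b hb => by simpa using hy b hb
      add_mem' := fun {z w} hz hw y hy b hb => by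
        rw [mul_add, mul_add, add_mul, hz y hy b hb, hw y hy b hb, add_zero]
      zero_mem' := fun y _ b _ => by simp
      neg_mem' := fun {z} hz y hy b hb => by simp [hz y hy b hb] }
  have hT : T = ⊤ := by
    refine E.subring_eq_top T (fun s y hy b hb => ?_) fun i y hy b hb => ?_
    · have := hy (s * b) fun r => by simpa only [mul_assoc] using hb (r * s)
      simpa only [map_mul, mul_assoc] using this
    · have h1 := hy (E.σ i b) fun r => (hcomp.sigma _ _ i).1 (hb r)
      have h2 := hy (E.δ i b) fun r => hcomp.delta i (hb r)
      have key : E.ι a * (y * E.x i) * E.ι b =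
          E.ι a * y * E.ι (E.σ i b) * E.x i + E.ι a * y * E.ι (E.δ i b) := by
        rw [← mul_assoc, mul_assoc _ (E.x i), E.comm_rel]
        noncomm_ring
      rw [key, h1, h2, zero_mul, add_zero]
  have hy : y ∈ T := hT ▸ Subring.mem_top y
  have := hy 1 (fun b hb => by simpa using congrArg E.ι (hb 1)) e h
  rwa [one_mul] at this

theorem ofCoeff_mul_mul_ι (hcomp : E.SigmaDeltaCompatible) {c : (Fin n → ℕ) →₀ R} {e : R}
    (h : ∀ α r, c α * r * e = 0) (y : A) : E.ofCoeff c * y * E.ι e = 0 := by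
  rw [ofCoeff_apply, Finsupp.sum, Finset.sum_mul, Finset.sum_mul]
  refine Finset.sum_eq_zero fun α _ => ?_
  rw [mul_assoc (E.ι _)]
  exact ι_mul_mul_ι hcomp (h α) _

/-- The degree-lexicographic key of an exponent vector. -/
def degLexKey (α : Fin n → ℕ) : ℕ ×ₗ Lex (Fin n → ℕ) := toLex (∑ i, α i, toLex α)

theorem degLexKey_injective : Function.Injective (degLexKey (n := n)) := fun α β h => by
  have := congrArg (fun z => (ofLex z).2) h
  exact toLex.injective this

theorem degLexKey_add (α β : Fin n → ℕ) :
    degLexKey (α + β) = degLexKey α + degLexKey β := by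
  simp only [degLexKey, Pi.add_apply, Finset.sum_add_distrib]
  rfl

theorem sum_le_of_degLexKey_le {α β : Fin n → ℕ} (h : degLexKey α ≤ degLexKey β) :
    ∑ i, α i ≤ ∑ i, β i := by
  rcases Prod.Lex.le_iff.1 h with h | h
  · exact h.le
  · exact h.1.le

theorem exists_max_degLexKey {c : (Fin n → ℕ) →₀ R} (hc : c ≠ 0) :
    ∃ α ∈ c.support, ∀ β ∈ c.support, degLexKey β ≤ degLexKey α :=
  c.support.exists_max_image degLexKey (Finsupp.support_nonempty_iff.2 hc)

theorem leading_mul_leading (hbij : E.Bijective) (hcomp : E.SigmaDeltaCompatible)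
    {cf cg : (Fin n → ℕ) →₀ R} (h : ∀ y, E.ofCoeff cf * y * E.ofCoeff cg = 0) {α₀ β₀ : Fin n → ℕ}
    (hα : α₀ ∈ cf.support) (hα' : ∀ α ∈ cf.support, degLexKey α ≤ degLexKey α₀)
    (hβ : β₀ ∈ cg.support) (hβ' : ∀ β ∈ cg.support, degLexKey β ≤ degLexKey β₀) (s : R) :
    cf α₀ * s * cg β₀ = 0 := by
  choose τ u hτ hu hτc hmem using term_mul_term (E := E) hbij hcomp
  obtain ⟨r, rfl⟩ := hτ α₀ β₀ s
  have hcoeff : ∀ α ∈ cf.support, ∀ β ∈ cg.support,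
      E.coeff (E.ι (cf α) * monom E.x α * (E.ι (r * cg β) * monom E.x β)) (α₀ + β₀) =
        Finsupp.single (α + β) (cf α * τ α β (r * cg β) * u α β) (α₀ + β₀) := by
    intro α hαs β hβs
    have hle : degLexKey (α + β) ≤ degLexKey (α₀ + β₀) := by
      rw [degLexKey_add, degLexKey_add]
      exact add_le_add (hα' α hαs) (hβ' β hβs)
    have hs := sum_le_of_degLexKey_le hle
    have := coeff_low (hmem α β (cf α) (r * cg β)) (γ := α₀ + β₀)
      (by simpa [Finset.sum_add_distrib] using hs)
    rw [map_sub, coeff_term, Finsupp.sub_apply, sub_eq_zero] at this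
    exact this
  have hne : ∀ α ∈ cf.support, ∀ β ∈ cg.support, α + β = α₀ + β₀ → α = α₀ ∧ β = β₀ := by
    intro α hαs β hβs heq
    have hk := congrArg degLexKey heq
    rw [degLexKey_add, degLexKey_add] at hk
    have := (add_eq_add_iff_eq_and_eq (hα' α hαs) (hβ' β hβs)).1 hk
    exact ⟨degLexKey_injective this.1, degLexKey_injective this.2⟩
  have hprod : E.ofCoeff cf * E.ι r * E.ofCoeff cg = ∑ α ∈ cf.support, ∑ β ∈ cg.support,
      E.ι (cf α) * monom E.x α * (E.ι (r * cg β) * monom E.x β) := by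
    rw [mul_assoc, ofCoeff_apply, ofCoeff_apply, Finsupp.sum, Finsupp.sum, Finset.mul_sum,
      Finset.sum_mul_sum]
    simp only [map_mul, mul_assoc]
  have hzero := congrArg (fun z => E.coeff z (α₀ + β₀)) (hprod.symm.trans (h (E.ι r)))
  simp only [map_sum, Finsupp.finsetSum_apply, map_zero, Finsupp.zero_apply] at hzero
  rw [Finset.sum_congr rfl fun α hα => Finset.sum_congr rfl fun β hβ => hcoeff α hα β hβ,
    Finset.sum_eq_single_of_mem α₀ hα, Finset.sum_eq_single_of_mem β₀ hβ,
    Finsupp.single_eq_same] at hzero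
  · have h1 := (hu α₀ β₀).mul_left_eq_zero.1 hzero
    rw [map_mul, ← mul_assoc] at h1
    exact (hτc α₀ β₀ _ _).2 h1
  · intro β hβs hneq
    exact Finsupp.single_eq_of_ne fun heq => hneq (hne α₀ hα β hβs heq.symm).2
  · intro α hαs hneq
    refine Finset.sum_eq_zero fun β hβs => ?_
    exact Finsupp.single_eq_of_ne fun heq => hneq (hne α hαs β hβs heq.symm).1

theorem coeff_mul_leading (hbij : E.Bijective) (hpq : IsRightPQBaer R)
    (hcomp : E.SigmaDeltaCompatible) {cf cg : (Fin n → ℕ) →₀ R}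
    (h : ∀ y, E.ofCoeff cf * y * E.ofCoeff cg = 0) {β₀ : Fin n → ℕ}
    (hβ : β₀ ∈ cg.support) (hβ' : ∀ β ∈ cg.support, degLexKey β ≤ degLexKey β₀)
    (α : Fin n → ℕ) (r : R) : cf α * r * cg β₀ = 0 := by
  classical
  induction hN : cf.support.card generalizing cf cg α r with
  | zero =>
    rw [Finset.card_eq_zero, Finsupp.support_eq_empty] at hN
    simp [hN]
  | succ N ih =>
    have hcf : cf ≠ 0 := by
      rintro rfl
      simp at hN
    obtain ⟨α₀, hα₀, hmax⟩ := exists_max_degLexKey hcf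
    have hlead := leading_mul_leading hbij hcomp h hα₀ hmax hβ hβ'
    by_cases hα : α = α₀
    · exact hα ▸ hlead r
    obtain ⟨e, he, hC⟩ := hpq.exists_finset {cf α₀}
    simp only [Finset.mem_singleton, forall_eq] at hC
    have heb : e * cg β₀ = cg β₀ := (hC _).1 hlead
    have hsplit : E.ofCoeff (cf.erase α₀) = E.ofCoeff cf - E.ι (cf α₀) * monom E.x α₀ := by
      rw [← ofCoeff_single, ← map_sub]
      congr 1
      exact eq_sub_of_add_eq (cf.erase_add_single α₀)
    have hih := ih (cf := cf.erase α₀) (cg := cg.mapRange (e * ·) (mul_zero e)) (fun y => ?_)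
      (by simpa [heb] using hβ)
      (fun β hβs => hβ' β (Finsupp.support_mapRange hβs)) α r
      (by rw [Finsupp.support_erase, Finset.card_erase_of_mem hα₀, hN]; rfl)
    · simpa [heb, Finsupp.erase_ne hα] using hih
    · rw [← ι_mul_ofCoeff, hsplit, sub_mul, sub_mul, ← mul_assoc, ← mul_assoc,
        mul_assoc (E.ofCoeff cf), h, mul_assoc (E.ι (cf α₀)),
        ι_mul_mul_ι hcomp ((hC e).2 he), zero_mul, sub_zero]

/-- If `fAg = 0` then `aRb = 0` for all coefficients `a` of `f` and `b` of `g`. -/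
theorem coeff_mul_coeff (hbij : E.Bijective) (hpq : IsRightPQBaer R)
    (hcomp : E.SigmaDeltaCompatible) {cf cg : (Fin n → ℕ) →₀ R}
    (h : ∀ y, E.ofCoeff cf * y * E.ofCoeff cg = 0) (α β : Fin n → ℕ) (r : R) :
    cf α * r * cg β = 0 := by
  classical
  induction hN : cg.support.card generalizing cg β with
  | zero =>
    rw [Finset.card_eq_zero, Finsupp.support_eq_empty] at hN
    simp [hN]
  | succ N ih =>
    have hcg : cg ≠ 0 := by
      rintro rfl
      simp at hN
    obtain ⟨β₀, hβ₀, hmax⟩ := exists_max_degLexKey hcg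
    have hlead := coeff_mul_leading hbij hpq hcomp h hβ₀ hmax
    by_cases hβ : β = β₀
    · exact hβ ▸ hlead α r
    have hsplit : E.ofCoeff (cg.erase β₀) = E.ofCoeff cg - E.ι (cg β₀) * monom E.x β₀ := by
      rw [← ofCoeff_single, ← map_sub]
      congr 1
      exact eq_sub_of_add_eq (cg.erase_add_single β₀)
    have hih := ih (cg := cg.erase β₀) (fun y => ?_) β
      (by rw [Finsupp.support_erase, Finset.card_erase_of_mem hβ₀, hN]; rfl)
    · rwa [Finsupp.erase_ne hβ] at hih
    · rw [hsplit, mul_sub, h, ← mul_assoc, ofCoeff_mul_mul_ι hcomp hlead, zero_mul, sub_zero]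

end SkewPBWExt

open SkewPBWExt in
/-- If the extension is bijective and `R` is a right p.q.-Baer `(Σ,Δ)`-compatible
ring, then the skew PBW extension `A` has Property (a.c.) on the right. -/
theorem bijective_rightPQBaer_hasRightAC {R A : Type*} [Ring R] [Ring A] {n : ℕ} (E : SkewPBWExt R A n)
    (hbij : E.Bijective) (hpq : IsRightPQBaer R) (hcomp : E.SigmaDeltaCompatible) :
    HasRightAC A := by
  classical
  intro m f
  obtain ⟨e, he, hC⟩ := hpq.exists_finset
    (Finset.univ.biUnion fun i => (E.coeff (f i)).support.image (E.coeff (f i)))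
  have hC' : ∀ b, (∀ i α r, E.coeff (f i) α * r * b = 0) ↔ e * b = b := by
    intro b
    rw [← hC]
    constructor
    · intro h c hc r
      simp only [Finset.mem_biUnion, Finset.mem_image] at hc
      obtain ⟨i, -, α, -, rfl⟩ := hc
      exact h i α r
    · intro h i α r
      by_cases hα : α ∈ (E.coeff (f i)).support
      · exact h _ (Finset.mem_biUnion.2 ⟨i, Finset.mem_univ i, Finset.mem_image_of_mem _ hα⟩) r
      · rw [Finsupp.notMem_support_iff.1 hα, zero_mul, zero_mul]
  have hsemi : ∀ r, (1 - e) * r * e = 0 := fun r => by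
    have : e * (r * e) = r * e := (hC' _).1 fun i α s => by
      simpa only [mul_assoc] using (hC' e).2 he i α (s * r)
    rw [sub_mul, sub_mul, one_mul, mul_assoc, this, sub_self]
  refine ⟨E.ι (1 - e), Set.ext fun g => ⟨fun hg => ?_, fun hg => ?_⟩⟩
  · have hfg : ∀ i y, f i * y * g = 0 := fun i y =>
      hg _ ⟨Pi.single i y, by simp [Pi.single_apply]⟩
    have hcoeff : ∀ β, e * E.coeff g β = E.coeff g β := fun β => (hC' _).1 fun i α r =>
      coeff_mul_coeff hbij hpq hcomp
        (fun y => by rw [ofCoeff_coeff, ofCoeff_coeff, hfg]) α β r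
    have hge : E.ι e * g = g := by
      conv_lhs => rw [← E.ofCoeff_coeff g]
      conv_rhs => rw [← E.ofCoeff_coeff g]
      rw [ι_mul_ofCoeff]
      congr 1
      ext β
      simpa using hcoeff β
    rintro _ ⟨y, rfl⟩
    change E.ι (1 - e) * y * g = 0
    rw [← hge, ← mul_assoc, ι_mul_mul_ι hcomp hsemi, zero_mul]
  · have hge : E.ι e * g = g := by
      have := hg _ ⟨1, rfl⟩
      simp only [mul_one, map_sub, map_one, sub_mul, one_mul] at this
      exact (sub_eq_zero.1 this).symm
    rintro _ ⟨s, rfl⟩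
    rw [Finset.sum_mul]
    refine Finset.sum_eq_zero fun i _ => ?_
    rw [← hge, ← mul_assoc, ← E.ofCoeff_coeff (f i), ofCoeff_mul_mul_ι hcomp ((hC' e).2 he i), zero_mul]
end
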